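/- Let p be a prime, N ∈ ℕ, let H_{p,N} be the first N points of the Halton sequence in base p, let m ∈ ℕ be minimal such that N < p^m, and let 0 < γ_1 ≤ 1. Then ∫_0^1 e²_{N,1}(H_{p,N} ⊕_p σ) dσ ≥ p^{−m} Σ_{ℓ=0}^{p^m − 1} e²_{N,1}(H_{p,N} ⊕_{p,m}^{simi} (ℓ/p^m)). In particular, there exists σ' ∈ ℚ(p^m) with e²_{N,1}(H_{p,N} ⊕_{p,m}^{simi} σ') ≤ ∫_0^1 e²_{N,1}(H_{p,N} ⊕_p σ) dσ. -/

import Mathlib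

open MeasureTheory Finset

/-- The digit of `x ∈ [0,1)` at base-`p` position `r` (the coefficient of `p^{-(r+1)}`),
using the finite expansion for `p`-adic rationals. -/
noncomputable def rdigit (p : ℕ) (x : ℝ) (r : ℕ) : ℕ :=
  (⌊x * (p : ℝ) ^ (r + 1)⌋).toNat % p

/-- The value of the `p`-adic integer `φ_p^+(x)` modulo `p^m`, as a natural number. -/
noncomputable def truncVal (p : ℕ) (x : ℝ) (m : ℕ) : ℕ :=
  ∑ r ∈ Finset.range m, rdigit p x r * p ^ r

/-- Digit `r` of the `p`-adic sum `φ_p^+(x) +_{ℤ_p} φ_p^+(σ)`. -/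
noncomputable def sdigit (p : ℕ) (x σ : ℝ) (r : ℕ) : ℕ :=
  (truncVal p x (r + 1) + truncVal p σ (r + 1)) % p ^ (r + 1) / p ^ r

/-- The `p`-adic shift `x ⊕_p σ = φ_p(φ_p^+(x) +_{ℤ_p} φ_p^+(σ))` (the Monna map applied to
the `p`-adic sum, taken mod 1). -/
noncomputable def pshift (p : ℕ) (x σ : ℝ) : ℝ :=
  Int.fract (∑' r : ℕ, (sdigit p x σ r : ℝ) / (p : ℝ) ^ (r + 1))

/-- The simplified `p`-adic shift `x ⊕_{p,m}^{simp} σ`: the truncation of `x ⊕_p σ` to its `m`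
most significant base-`p` digits. -/
noncomputable def simpShift (p m : ℕ) (x σ : ℝ) : ℝ :=
  ∑ r ∈ Finset.range m, (sdigit p x σ r : ℝ) / (p : ℝ) ^ (r + 1)

/-- The mid-simplified `p`-adic shift `x ⊕_{p,m}^{simi} σ = (x ⊕_{p,m}^{simp} σ) + 1/(2p^m)`. -/
noncomputable def midShift (p m : ℕ) (x σ : ℝ) : ℝ :=
  simpShift p m x σ + 1 / (2 * (p : ℝ) ^ m)

/-- The radical inverse function `φ_p(n) = Σ_r n_r p^{-(r+1)}` in base `p`. -/
noncomputable def radInv (p n : ℕ) : ℝ :=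
  ∑' r : ℕ, ((n / p ^ r % p : ℕ) : ℝ) / (p : ℝ) ^ (r + 1)

/-- Membership in `ℚ(p^m) = {a p^{-m} : a = 0,1,…,p^m - 1}`. -/
def QSet (p m : ℕ) (x : ℝ) : Prop :=
  ∃ a : ℕ, a < p ^ m ∧ x = (a : ℝ) / (p : ℝ) ^ m

/-- The squared worst-case error of the QMC rule based on the `N`-element point set
`P ⊆ [0,1)^d` in the weighted anchored Sobolev space with weights `γ` (0-indexed, so the
paper's `γ_j` is `γ (j-1)`). -/
noncomputable def sqErr (d N : ℕ) (γ : ℕ → ℝ) (P : Fin N → Fin d → ℝ) : ℝ :=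
  (∏ j : Fin d, (1 + γ j.val / 3))
    - 2 / (N : ℝ) * ∑ n : Fin N, ∏ j : Fin d, (1 + γ j.val / 2 * (1 - P n j ^ 2))
    + 1 / (N : ℝ) ^ 2 *
        ∑ n : Fin N, ∑ h : Fin N, ∏ j : Fin d, (1 + γ j.val * min (1 - P n j) (1 - P h j))

lemma rdigit_eq_floor_div {p : ℕ} (hp : 0 < p) (x : ℝ) {r K : ℕ} (hr : r < K) :
    rdigit p x r = ⌊x * (p : ℝ) ^ K⌋₊ / p ^ (K - (r + 1)) % p := by
  have hp' : (p : ℝ) ≠ 0 := by positivity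
  rw [rdigit, Int.floor_toNat, ← Nat.floor_div_natCast]
  congr 2
  obtain ⟨k, rfl⟩ := Nat.exists_eq_add_of_lt hr
  rw [show r + k + 1 - (r + 1) = k by omega]
  push_cast
  field_simp
  ring

lemma rdigit_lt {p : ℕ} (hp : 0 < p) (x : ℝ) (r : ℕ) : rdigit p x r < p := Nat.mod_lt _ hp

lemma rdigit_congr {p : ℕ} (hp : 0 < p) {x y : ℝ} {K : ℕ}
    (h : ⌊x * (p : ℝ) ^ K⌋₊ = ⌊y * (p : ℝ) ^ K⌋₊) {r : ℕ} (hr : r < K) :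
    rdigit p x r = rdigit p y r := by
  rw [rdigit_eq_floor_div hp x hr, rdigit_eq_floor_div hp y hr, h]

lemma truncVal_succ (p : ℕ) (x : ℝ) (K : ℕ) :
    truncVal p x (K + 1) = truncVal p x K + rdigit p x K * p ^ K := by
  simp [truncVal, Finset.sum_range_succ]

lemma truncVal_congr {p : ℕ} (hp : 0 < p) {x y : ℝ} {K : ℕ}
    (h : ⌊x * (p : ℝ) ^ K⌋₊ = ⌊y * (p : ℝ) ^ K⌋₊) {r : ℕ} (hr : r ≤ K) :
    truncVal p x r = truncVal p y r := by
  unfold truncVal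
  refine Finset.sum_congr rfl fun i hi => ?_
  rw [rdigit_congr hp h ((Finset.mem_range.mp hi).trans_le hr)]

lemma sdigit_eq {p : ℕ} (hp : 0 < p) (x σ : ℝ) (r : ℕ) :
    sdigit p x σ r
      = ((truncVal p x r + truncVal p σ r) / p ^ r + rdigit p x r + rdigit p σ r) % p := by
  rw [sdigit, pow_succ, Nat.mod_mul_right_div_self, truncVal_succ, truncVal_succ,
    show truncVal p x r + rdigit p x r * p ^ r + (truncVal p σ r + rdigit p σ r * p ^ r)
      = truncVal p x r + truncVal p σ r + (rdigit p x r + rdigit p σ r) * p ^ r by ring,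
    Nat.add_mul_div_right _ _ (by positivity), add_assoc]

lemma sdigit_lt {p : ℕ} (hp : 0 < p) (x σ : ℝ) (r : ℕ) : sdigit p x σ r < p := by
  rw [sdigit_eq hp]
  exact Nat.mod_lt _ hp

lemma sdigit_comm (p : ℕ) (x σ : ℝ) (r : ℕ) : sdigit p x σ r = sdigit p σ x r := by
  rw [sdigit, sdigit, add_comm]

lemma sdigit_congr_right {p : ℕ} (hp : 0 < p) (x : ℝ) {σ τ : ℝ} {K : ℕ}
    (h : ⌊σ * (p : ℝ) ^ K⌋₊ = ⌊τ * (p : ℝ) ^ K⌋₊) {r : ℕ} (hr : r < K) :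
    sdigit p x σ r = sdigit p x τ r := by
  rw [sdigit, sdigit, truncVal_congr hp h hr]

lemma midShift_congr_right {p : ℕ} (hp : 0 < p) (x : ℝ) {σ τ : ℝ} {K : ℕ}
    (h : ⌊σ * (p : ℝ) ^ K⌋₊ = ⌊τ * (p : ℝ) ^ K⌋₊) :
    midShift p K x σ = midShift p K x τ := by
  unfold midShift simpShift
  congr 1
  refine Finset.sum_congr rfl fun i hi => ?_
  rw [sdigit_congr_right hp x h (Finset.mem_range.mp hi)]

/-- The numerator of `simpShift p K x σ` over the denominator `p ^ K`. -/
noncomputable def shiftNum (p : ℕ) (x σ : ℝ) : ℕ → ℕ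
  | 0 => 0
  | K + 1 => p * shiftNum p x σ K + sdigit p x σ K

lemma simpShift_eq_shiftNum {p : ℕ} (hp : 0 < p) (x σ : ℝ) (K : ℕ) :
    simpShift p K x σ = shiftNum p x σ K / (p : ℝ) ^ K := by
  induction K with
  | zero => simp [simpShift, shiftNum]
  | succ K ih =>
    have : simpShift p (K + 1) x σ
        = simpShift p K x σ + (sdigit p x σ K : ℝ) / (p : ℝ) ^ (K + 1) := by
      simp [simpShift, Finset.sum_range_succ]
    rw [this, ih, shiftNum]
    push_cast
    field_simp
    ring

lemma shiftNum_lt {p : ℕ} (hp : 0 < p) (x σ : ℝ) (K : ℕ) : shiftNum p x σ K < p ^ K := by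
  induction K with
  | zero => simp [shiftNum]
  | succ K ih =>
    have := sdigit_lt hp x σ K
    rw [shiftNum, pow_succ]
    nlinarith

/-- The `p`-adic shift by a fixed `σ` is injective on truncations. -/
lemma rdigit_eq_of_shiftNum_eq {p : ℕ} (hp : 0 < p) {x y σ : ℝ} {K : ℕ}
    (h : shiftNum p x σ K = shiftNum p y σ K) {r : ℕ} (hr : r < K) :
    rdigit p x r = rdigit p y r := by
  suffices truncVal p x K = truncVal p y K ∧ ∀ r < K, rdigit p x r = rdigit p y r from
    this.2 r hr
  clear hr
  induction K with
  | zero => simp [truncVal]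
  | succ K ih =>
    have hx := sdigit_lt hp x σ K
    have hy := sdigit_lt hp y σ K
    simp only [shiftNum] at h
    have hmod : sdigit p x σ K = sdigit p y σ K := by
      have := congrArg (· % p) h
      simpa [Nat.mul_add_mod, Nat.mod_eq_of_lt hx, Nat.mod_eq_of_lt hy] using this
    have hS : shiftNum p x σ K = shiftNum p y σ K := by
      rw [hmod] at h
      exact Nat.eq_of_mul_eq_mul_left hp (Nat.add_right_cancel h)
    obtain ⟨ht, hd⟩ := ih hS
    rw [sdigit_eq hp, sdigit_eq hp, ht] at hmod
    have hK : rdigit p x K = rdigit p y K := by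
      have h1 : rdigit p x K ≡ rdigit p y K [MOD p] :=
        Nat.ModEq.add_left_cancel' _ (Nat.ModEq.add_right_cancel' _ hmod)
      exact h1.eq_of_lt_of_lt (rdigit_lt hp x K) (rdigit_lt hp y K)
    refine ⟨by rw [truncVal_succ, truncVal_succ, ht, hK], fun r hr => ?_⟩
    rcases Nat.lt_succ_iff_lt_or_eq.mp hr with hr | rfl
    exacts [hd r hr, hK]

lemma summable_natDigits_div {p : ℕ} {d : ℕ → ℕ} (hd : ∀ r, d r < p) :
    Summable fun r => (d r : ℝ) / (p : ℝ) ^ (r + 1) := by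
  simp only [div_eq_mul_inv]
  exact Real.summable_ofDigitsTerm (digits := fun r => (⟨d r, hd r⟩ : Fin p))

lemma tsum_natDigits_div_le_one {p : ℕ} {d : ℕ → ℕ} (hd : ∀ r, d r < p) :
    ∑' r, (d r : ℝ) / (p : ℝ) ^ (r + 1) ≤ 1 := by
  simpa [Real.ofDigits, Real.ofDigitsTerm, div_eq_mul_inv] using
    Real.ofDigits_le_one (fun r => (⟨d r, hd r⟩ : Fin p))

lemma radInv_eq {p : ℕ} (hp : 1 < p) (n : ℕ) :
    radInv p n = ((n % p : ℕ) + radInv p (n / p)) / p := by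
  have hs := summable_natDigits_div (d := fun r => n / p ^ r % p)
    fun r => Nat.mod_lt _ (by omega)
  rw [radInv, hs.tsum_eq_zero_add, radInv, add_div, ← tsum_div_const]
  congr 1
  · simp
  · refine tsum_congr fun r => ?_
    rw [Nat.div_div_eq_div_mul, ← pow_succ', pow_succ (p : ℝ) (r + 1), div_div]

lemma radInv_mem_Ico {p : ℕ} (hp : 1 < p) (n : ℕ) : radInv p n ∈ Set.Ico (0 : ℝ) 1 := by
  induction n using Nat.strong_induction_on with
  | _ n ih =>
    rcases Nat.eq_zero_or_pos n with rfl | hn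
    · simp [radInv]
    · obtain ⟨h0, h1⟩ := ih (n / p) (Nat.div_lt_self hn hp)
      have hpos : (0 : ℝ) < p := by positivity
      rw [radInv_eq hp]
      refine ⟨by positivity, ?_⟩
      rw [div_lt_one hpos]
      have : ((n % p : ℕ) : ℝ) + 1 ≤ p := by exact_mod_cast Nat.mod_lt n (by omega)
      linarith

lemma rdigit_radInv {p : ℕ} (hp : 1 < p) (n r : ℕ) :
    rdigit p (radInv p n) r = n / p ^ r % p := by
  have hpos : (p : ℝ) ≠ 0 := by positivity
  induction r generalizing n with
  | zero =>
    obtain ⟨h0, h1⟩ := radInv_mem_Ico hp (n / p)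
    rw [rdigit, Int.floor_toNat, radInv_eq hp, zero_add, pow_one, div_mul_cancel₀ _ hpos,
      add_comm, Nat.floor_add_natCast h0, Nat.floor_eq_zero.mpr h1]
    simp
  | succ r ih =>
    obtain ⟨h0, h1⟩ := radInv_mem_Ico hp (n / p)
    have : radInv p n * (p : ℝ) ^ (r + 1 + 1)
        = radInv p (n / p) * (p : ℝ) ^ (r + 1) + ((n % p * p ^ (r + 1) : ℕ) : ℝ) := by
      rw [radInv_eq hp n]
      push_cast
      field_simp
      ring
    rw [pow_succ' p r, ← Nat.div_div_eq_div_mul, ← ih, rdigit, rdigit, Int.floor_toNat,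
      Int.floor_toNat, this, Nat.floor_add_natCast (by positivity), pow_succ p r, ← mul_assoc,
      Nat.add_mul_mod_self_right]

lemma shiftNum_radInv_injective {p : ℕ} (hp : 1 < p) (σ : ℝ) {K n h : ℕ} (hn : n < p ^ K)
    (hh : h < p ^ K) (heq : shiftNum p (radInv p n) σ K = shiftNum p (radInv p h) σ K) :
    n = h := by
  have hd : ∀ r < K, n / p ^ r % p = h / p ^ r % p := fun r hr => by
    rw [← rdigit_radInv hp, ← rdigit_radInv hp, rdigit_eq_of_shiftNum_eq (by omega) heq hr]
  have hmod : ∀ k ≤ K, n % p ^ k = h % p ^ k := by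
    intro k hk
    induction k with
    | zero => simp [Nat.mod_one]
    | succ k ih => rw [Nat.mod_pow_succ, Nat.mod_pow_succ, ih (by omega), hd k (by omega)]
  simpa [Nat.mod_eq_of_lt hn, Nat.mod_eq_of_lt hh] using hmod K le_rfl

lemma midShift_eq {p : ℕ} (hp : 0 < p) (x σ : ℝ) (K : ℕ) :
    midShift p K x σ = (shiftNum p x σ K + 1 / 2) / (p : ℝ) ^ K := by
  rw [midShift, simpShift_eq_shiftNum hp]
  field_simp

lemma midShift_mem_Icc {p : ℕ} (hp : 0 < p) (x σ : ℝ) (K : ℕ) :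
    midShift p K x σ ∈ Set.Icc (0 : ℝ) 1 := by
  have h : (shiftNum p x σ K : ℝ) + 1 ≤ (p : ℝ) ^ K := by
    exact_mod_cast shiftNum_lt hp x σ K
  rw [midShift_eq hp]
  refine ⟨by positivity, ?_⟩
  rw [div_le_one (by positivity)]
  linarith

lemma sum_range_pow_succ (p K : ℕ) (f : ℕ → ℝ) :
    ∑ l ∈ range (p ^ (K + 1)), f l = ∑ l ∈ range (p ^ K), ∑ j ∈ range p, f (l * p + j) := by
  rw [pow_succ]
  induction p ^ K with
  | zero => simp
  | succ n ih => rw [Finset.sum_range_succ, ← ih, Nat.succ_mul, Finset.sum_range_add]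

lemma sum_range_add_mod {p : ℕ} (hp : 0 < p) (c : ℕ) (f : ℕ → ℝ) :
    ∑ j ∈ range p, f ((c + j) % p) = ∑ j ∈ range p, f j := by
  have hinj : Set.InjOn (fun j => (c + j) % p) (range p : Set ℕ) := by
    intro a ha b hb hab
    have h1 : a ≡ b [MOD p] := Nat.ModEq.add_left_cancel' c hab
    exact h1.eq_of_lt_of_lt (by simpa using ha) (by simpa using hb)
  have himg : (range p).image (fun j => (c + j) % p) = range p := by
    refine Finset.eq_of_subset_of_card_le ?_ (by rw [Finset.card_image_of_injOn hinj])
    intro a ha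
    obtain ⟨j, -, rfl⟩ := Finset.mem_image.mp ha
    exact Finset.mem_range.mpr (Nat.mod_lt _ hp)
  conv_rhs => rw [← himg]
  rw [Finset.sum_image hinj]

lemma floor_refine {p : ℕ} (hp : 0 < p) (K l j : ℕ) (hj : j < p) :
    ⌊((l * p + j : ℕ) : ℝ) / (p : ℝ) ^ (K + 1) * (p : ℝ) ^ K⌋₊ = l := by
  have : ((l * p + j : ℕ) : ℝ) / (p : ℝ) ^ (K + 1) * (p : ℝ) ^ K
      = ((l * p + j : ℕ) : ℝ) / (p : ℕ) := by
    field_simp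
    ring
  rw [this, Nat.floor_div_eq_div, mul_comm, Nat.mul_add_div hp, Nat.div_eq_of_lt hj, add_zero]

lemma floor_div_mul_self {q : ℝ} (hq : 0 < q) (l : ℕ) : ⌊(l : ℝ) / q * q⌋₊ = l := by
  rw [div_mul_cancel₀ _ hq.ne', Nat.floor_natCast]

lemma shiftNum_congr_right {p : ℕ} (hp : 0 < p) (x : ℝ) {σ τ : ℝ} {K : ℕ}
    (h : ⌊σ * (p : ℝ) ^ K⌋₊ = ⌊τ * (p : ℝ) ^ K⌋₊) :
    shiftNum p x σ K = shiftNum p x τ K := by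
  have := midShift_congr_right hp x h
  rw [midShift_eq hp, midShift_eq hp, div_left_inj' (by positivity), add_left_inj] at this
  exact_mod_cast this

/-- Refining a shift by one digit `j` permutes the next digit of the shifted point. -/
lemma exists_shiftNum_refine {p : ℕ} (hp : 0 < p) (x : ℝ) (K l : ℕ) :
    ∃ c : ℕ, ∀ j < p, shiftNum p x (((l * p + j : ℕ) : ℝ) / (p : ℝ) ^ (K + 1)) (K + 1)
      = p * shiftNum p x ((l : ℝ) / (p : ℝ) ^ K) K + (c + j) % p := by
  have hpK : (0 : ℝ) < (p : ℝ) ^ K := by positivity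
  refine ⟨(truncVal p x K + truncVal p ((l : ℝ) / (p : ℝ) ^ K) K) / p ^ K + rdigit p x K,
    fun j hj => ?_⟩
  have hfl : ⌊((l * p + j : ℕ) : ℝ) / (p : ℝ) ^ (K + 1) * (p : ℝ) ^ K⌋₊
      = ⌊(l : ℝ) / (p : ℝ) ^ K * (p : ℝ) ^ K⌋₊ := by
    rw [floor_refine hp K l j hj, floor_div_mul_self hpK]
  have hdig : rdigit p (((l * p + j : ℕ) : ℝ) / (p : ℝ) ^ (K + 1)) K = j := by
    rw [rdigit_eq_floor_div hp _ (Nat.lt_succ_self K), floor_div_mul_self (by positivity)]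
    simp [Nat.mod_eq_of_lt hj]
  rw [shiftNum, sdigit_eq hp, hdig, shiftNum_congr_right hp x hfl,
    truncVal_congr hp hfl le_rfl]

/-- The one-dimensional squared worst-case error as a function of the points. -/
noncomputable def sqErrOne (N : ℕ) (γ : ℝ) (y : Fin N → ℝ) : ℝ :=
  sqErr 1 N (fun _ => γ) fun n _ => y n

lemma sqErrOne_eq (N : ℕ) (γ : ℝ) (y : Fin N → ℝ) :
    sqErrOne N γ y = (1 + γ / 3) - 2 / (N : ℝ) * ∑ n, (1 + γ / 2 * (1 - y n ^ 2))
      + 1 / (N : ℝ) ^ 2 * ∑ n, ∑ h, (1 + γ * min (1 - y n) (1 - y h)) := by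
  simp [sqErrOne, sqErr]

lemma continuous_sqErrOne (N : ℕ) (γ : ℝ) : Continuous (sqErrOne N γ) := by
  simp only [funext (sqErrOne_eq N γ)]
  fun_prop

/-- Jensen's inequality for `sqErrOne` under mean-zero perturbations that do not change the
order of the points. -/
lemma card_mul_sqErrOne_le_sum {N : ℕ} {γ : ℝ} (hγ : 0 ≤ γ) (p : ℕ) (y : Fin N → ℝ)
    (z : ℕ → Fin N → ℝ) (hz : ∀ n, ∑ j ∈ range p, z j n = p * y n)
    (hmin : ∀ n h, (∀ j ∈ range p, z j n ≤ z j h) ∨ (∀ j ∈ range p, z j h ≤ z j n)) :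
    p * sqErrOne N γ y ≤ ∑ j ∈ range p, sqErrOne N γ (z j) := by
  rcases Nat.eq_zero_or_pos p with rfl | hp
  · simp
  have hp' : (0 : ℝ) < p := by positivity
  have hle : ∀ n h, (∀ j ∈ range p, z j n ≤ z j h) →
      ∑ j ∈ range p, min (1 - z j n) (1 - z j h) = p * min (1 - y n) (1 - y h) := by
    intro n h H
    have hy : y n ≤ y h := by
      have := Finset.sum_le_sum H
      rw [hz, hz] at this
      exact le_of_mul_le_mul_left this hp'
    rw [min_eq_right (by linarith), Finset.sum_congr rfl fun j hj =>
      min_eq_right (sub_le_sub_left (H j hj) 1)]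
    rw [Finset.sum_sub_distrib, hz]
    simp
    ring
  have hm : ∀ n h, ∑ j ∈ range p, min (1 - z j n) (1 - z j h)
      = p * min (1 - y n) (1 - y h) := by
    intro n h
    rcases hmin n h with H | H
    · exact hle n h H
    · simpa only [min_comm] using hle h n H
  have hsq : ∀ n, p * y n ^ 2 ≤ ∑ j ∈ range p, z j n ^ 2 := by
    intro n
    have h0 : 0 ≤ ∑ j ∈ range p, (z j n - y n) ^ 2 := Finset.sum_nonneg fun _ _ => sq_nonneg _
    have h1 : ∑ j ∈ range p, (z j n - y n) ^ 2
        = ∑ j ∈ range p, z j n ^ 2 - 2 * y n * ∑ j ∈ range p, z j n + p * y n ^ 2 := by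
      simp only [sub_sq, Finset.sum_add_distrib, Finset.sum_sub_distrib, Finset.sum_const,
        card_range, nsmul_eq_mul, Finset.mul_sum]
      congr 2
      exact Finset.sum_congr rfl fun _ _ => by ring
    rw [h1, hz] at h0
    nlinarith
  have h1 : ∑ j ∈ range p, ∑ n, (1 + γ / 2 * (1 - z j n ^ 2))
      ≤ (p : ℝ) * ∑ n, (1 + γ / 2 * (1 - y n ^ 2)) := by
    rw [Finset.sum_comm, Finset.mul_sum]
    refine Finset.sum_le_sum fun n _ => ?_
    simp only [Finset.sum_add_distrib, ← Finset.mul_sum, Finset.sum_sub_distrib,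
      Finset.sum_const, card_range, nsmul_eq_mul, mul_one]
    nlinarith [mul_le_mul_of_nonneg_left (hsq n) hγ]
  have h2 : ∑ j ∈ range p, ∑ n, ∑ h, (1 + γ * min (1 - z j n) (1 - z j h))
      = (p : ℝ) * ∑ n, ∑ h, (1 + γ * min (1 - y n) (1 - y h)) := by
    rw [Finset.sum_comm, Finset.mul_sum]
    refine Finset.sum_congr rfl fun n _ => ?_
    rw [Finset.sum_comm, Finset.mul_sum]
    refine Finset.sum_congr rfl fun h _ => ?_
    rw [Finset.sum_add_distrib, ← Finset.mul_sum, hm]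
    simp
    ring
  simp only [sqErrOne_eq]
  rw [Finset.sum_add_distrib (s := range p), Finset.sum_sub_distrib (s := range p),
    ← Finset.mul_sum (s := range p), ← Finset.mul_sum (s := range p), h2]
  have h3 := mul_le_mul_of_nonneg_left h1 (show 0 ≤ 2 / (N : ℝ) by positivity)
  simp only [Finset.sum_const, card_range, nsmul_eq_mul]
  linarith

/-- The mean of the squared worst-case error over all mid-simplified shifts in `ℚ(p ^ K)`. -/
noncomputable def avgMidErr (p N K : ℕ) (γ : ℝ) : ℝ :=
  ((p : ℝ) ^ K)⁻¹ * ∑ l ∈ range (p ^ K),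
    sqErrOne N γ fun n => midShift p K (radInv p n.val) ((l : ℝ) / (p : ℝ) ^ K)

lemma sum_range_natCast_mul_two (p : ℕ) :
    (∑ j ∈ range p, (j : ℝ)) * 2 = p * (p - 1) := by
  induction p with
  | zero => simp
  | succ p ih =>
    rw [Finset.sum_range_succ, add_mul, ih]
    push_cast
    ring

lemma avgMidErr_le_succ {p : ℕ} (hp : 1 < p) {N K : ℕ} (hNK : N < p ^ K) {γ : ℝ}
    (hγ : 0 ≤ γ) : avgMidErr p N K γ ≤ avgMidErr p N (K + 1) γ := by
  have hp0 : 0 < p := by omega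
  have hpR : (0 : ℝ) < p := by positivity
  unfold avgMidErr
  rw [sum_range_pow_succ, pow_succ, mul_inv, mul_assoc]
  refine mul_le_mul_of_nonneg_left ?_ (by positivity)
  rw [Finset.mul_sum]
  refine Finset.sum_le_sum fun l _ => ?_
  rw [← div_eq_inv_mul, le_div_iff₀' hpR]
  refine card_mul_sqErrOne_le_sum hγ p _
    (fun j n => midShift p (K + 1) (radInv p n.val)
      (((l * p + j : ℕ) : ℝ) / (p : ℝ) ^ (K + 1))) (fun n => ?_) fun n h => ?_
  · obtain ⟨c, hc⟩ := exists_shiftNum_refine hp0 (radInv p n.val) K l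
    let f : ℕ → ℝ := fun s => ((p : ℝ) * shiftNum p (radInv p n.val) ((l : ℝ) / (p : ℝ) ^ K) K
      + s + 1 / 2) / (p : ℝ) ^ (K + 1)
    have hf : ∀ j ∈ range p, midShift p (K + 1) (radInv p n.val)
        (((l * p + j : ℕ) : ℝ) / (p : ℝ) ^ (K + 1)) = f ((c + j) % p) := by
      intro j hj
      rw [midShift_eq hp0, hc j (Finset.mem_range.mp hj)]
      push_cast
      rfl
    refine (Finset.sum_congr rfl hf).trans ((sum_range_add_mod hp0 c f).trans ?_)
    rw [midShift_eq hp0, ← Finset.sum_div,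
      Finset.sum_add_distrib, Finset.sum_add_distrib]
    simp only [Finset.sum_const, card_range, nsmul_eq_mul]
    have h2 := sum_range_natCast_mul_two p
    have h3 : ∑ j ∈ range p, (j : ℝ) = p * (p - 1) / 2 := by linarith
    rw [h3]
    field_simp
    ring
  · rcases eq_or_ne n h with rfl | hne
    · exact Or.inl fun _ _ => le_rfl
    have key : ∀ a b : Fin N, shiftNum p (radInv p a.val) ((l : ℝ) / (p : ℝ) ^ K) K
        < shiftNum p (radInv p b.val) ((l : ℝ) / (p : ℝ) ^ K) K →
        ∀ j ∈ range p, midShift p (K + 1) (radInv p a.val)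
          (((l * p + j : ℕ) : ℝ) / (p : ℝ) ^ (K + 1)) ≤ midShift p (K + 1) (radInv p b.val)
          (((l * p + j : ℕ) : ℝ) / (p : ℝ) ^ (K + 1)) := by
      intro a b hab j hj
      obtain ⟨c, hc⟩ := exists_shiftNum_refine hp0 (radInv p a.val) K l
      obtain ⟨d, hd⟩ := exists_shiftNum_refine hp0 (radInv p b.val) K l
      rw [midShift_eq hp0, midShift_eq hp0, hc j (Finset.mem_range.mp hj),
        hd j (Finset.mem_range.mp hj)]
      have := Nat.mod_lt (c + j) hp0
      gcongr (?_ + _) / _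
      have hmul := Nat.mul_le_mul_left p (Nat.succ_le_of_lt hab)
      rw [Nat.mul_succ] at hmul
      exact Nat.cast_le.mpr (by linarith [Nat.zero_le ((d + j) % p)])
    rcases lt_trichotomy (shiftNum p (radInv p n.val) ((l : ℝ) / (p : ℝ) ^ K) K)
      (shiftNum p (radInv p h.val) ((l : ℝ) / (p : ℝ) ^ K) K) with H | H | H
    · exact Or.inl (key n h H)
    · exact absurd (Fin.ext (shiftNum_radInv_injective hp _ (n.2.trans hNK) (h.2.trans hNK) H))
        hne
    · exact Or.inr (key h n H)

lemma integral_step_function {q : ℝ} (hq : 0 < q) (g : ℕ → ℝ) (k : ℕ) :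
    IntegrableOn (fun x : ℝ => g ⌊x * q⌋₊) (Set.Ico 0 (k / q)) ∧
      ∫ x in Set.Ico (0 : ℝ) (k / q), g ⌊x * q⌋₊ = q⁻¹ * ∑ l ∈ range k, g l := by
  induction k with
  | zero => simp
  | succ k ih =>
    obtain ⟨hi, hv⟩ := ih
    have hk : (k : ℝ) / q ≤ ((k + 1 : ℕ) : ℝ) / q := by
      gcongr
      simp
    have hconst : Set.EqOn (fun x : ℝ => g ⌊x * q⌋₊) (fun _ => g k)
        (Set.Ico (k / q) ((k + 1 : ℕ) / q)) := by
      rintro x ⟨h1, h2⟩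
      rw [div_le_iff₀ hq] at h1
      rw [lt_div_iff₀ hq] at h2
      have : ⌊x * q⌋₊ = k := by
        rw [Nat.floor_eq_iff (le_trans (by positivity) h1)]
        exact ⟨h1, by exact_mod_cast h2⟩
      simp [this]
    have hi' : IntegrableOn (fun x : ℝ => g ⌊x * q⌋₊) (Set.Ico (k / q) ((k + 1 : ℕ) / q)) :=
      (integrableOn_congr_fun hconst measurableSet_Ico).mpr (by simp [integrableOn_const_iff])
    have hu := Set.Ico_union_Ico_eq_Ico (show (0 : ℝ) ≤ k / q by positivity) hk
    have hd : Disjoint (Set.Ico (0 : ℝ) (k / q)) (Set.Ico (k / q) ((k + 1 : ℕ) / q)) :=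
      Set.Ico_disjoint_Ico_same
    rw [← hu]
    refine ⟨hi.union hi', ?_⟩
    rw [setIntegral_union hd measurableSet_Ico hi hi', hv,
      setIntegral_congr_fun measurableSet_Ico hconst, setIntegral_const, Finset.sum_range_succ,
      Real.volume_real_Ico_of_le hk, smul_eq_mul]
    push_cast
    field_simp
    ring

lemma avgMidErr_eq_integral {p : ℕ} (hp : 0 < p) (N K : ℕ) (γ : ℝ) :
    avgMidErr p N K γ = ∫ σ in Set.Ico (0 : ℝ) 1,
      sqErrOne N γ fun n => midShift p K (radInv p n.val) σ := by
  have hpK : (0 : ℝ) < (p : ℝ) ^ K := by positivity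
  have := (integral_step_function hpK (fun l => sqErrOne N γ fun n =>
    midShift p K (radInv p n.val) ((l : ℝ) / (p : ℝ) ^ K)) (p ^ K)).2
  rw [Nat.cast_pow, div_self hpK.ne'] at this
  rw [avgMidErr, ← this]
  congr 1
  ext σ
  congr 1
  ext n
  exact midShift_congr_right hp _ (floor_div_mul_self hpK _)

lemma measurable_midShift {p : ℕ} (hp : 0 < p) (K : ℕ) (x : ℝ) :
    Measurable (midShift p K x) := by
  have hpK : (0 : ℝ) < (p : ℝ) ^ K := by positivity
  have : midShift p K x
      = (fun l : ℕ => midShift p K x ((l : ℝ) / (p : ℝ) ^ K)) ∘ fun σ => ⌊σ * (p : ℝ) ^ K⌋₊ := by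
    ext σ
    exact midShift_congr_right hp _ (floor_div_mul_self hpK _).symm
  rw [this]
  exact measurable_from_top.comp (Nat.measurable_floor.comp (measurable_id.mul_const _))

lemma hasSum_sdigit {p : ℕ} (hp : 1 < p) (x σ : ℝ) :
    HasSum (fun r => (sdigit p x σ r : ℝ) / (p : ℝ) ^ (r + 1))
      (∑' r : ℕ, (sdigit p x σ r : ℝ) / (p : ℝ) ^ (r + 1)) :=
  (summable_natDigits_div fun r => sdigit_lt (by omega) x σ r).hasSum

lemma tendsto_midShift {p : ℕ} (hp : 1 < p) (x σ : ℝ) :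
    Filter.Tendsto (fun K => midShift p K x σ) Filter.atTop
      (nhds (∑' r : ℕ, (sdigit p x σ r : ℝ) / (p : ℝ) ^ (r + 1))) := by
  have h1 := (hasSum_sdigit hp x σ).tendsto_sum_nat
  have h2 : Filter.Tendsto (fun K : ℕ => 1 / (2 * (p : ℝ) ^ K)) Filter.atTop (nhds 0) := by
    have := (tendsto_pow_atTop_nhds_zero_of_lt_one (r := (p : ℝ)⁻¹) (by positivity)
      (inv_lt_one_of_one_lt₀ (by exact_mod_cast hp))).const_mul (1 / 2)
    rw [mul_zero] at this
    refine this.congr fun K => ?_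
    rw [inv_pow]
    field_simp
  simpa [midShift, simpShift] using h1.add h2

lemma shiftNum_eq_of_tsum_eq_one {p : ℕ} (hp : 1 < p) {x σ : ℝ}
    (h : ∑' r : ℕ, (sdigit p x σ r : ℝ) / (p : ℝ) ^ (r + 1) = 1) (K : ℕ) :
    shiftNum p x σ K = p ^ K - 1 := by
  have hp0 : 0 < p := by omega
  have hpK : (0 : ℝ) < (p : ℝ) ^ K := by positivity
  have hlt := shiftNum_lt hp0 x σ K
  have hd : ∀ r, sdigit p x σ (r + K) < p := fun r => sdigit_lt hp0 x σ _
  have htail : ∑' r : ℕ, (sdigit p x σ (r + K) : ℝ) / (p : ℝ) ^ (r + K + 1)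
      ≤ 1 / (p : ℝ) ^ K := by
    have h1 := tsum_natDigits_div_le_one hd
    calc _ = (∑' r : ℕ, (sdigit p x σ (r + K) : ℝ) / (p : ℝ) ^ (r + 1)) / (p : ℝ) ^ K := by
            rw [← tsum_div_const]
            refine tsum_congr fun r => ?_
            rw [div_div, ← pow_add]
            congr 2
            ring
      _ ≤ _ := by gcongr
  have hsplit := (hasSum_sdigit hp x σ).summable.sum_add_tsum_nat_add K
  have hs := simpShift_eq_shiftNum hp0 x σ K
  unfold simpShift at hs
  rw [h, hs] at hsplit
  have : (1 : ℝ) ≤ shiftNum p x σ K / (p : ℝ) ^ K + 1 / (p : ℝ) ^ K := by linarith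
  rw [← add_div, one_le_div hpK] at this
  have : p ^ K ≤ shiftNum p x σ K + 1 := by exact_mod_cast this
  omega

lemma eq_of_rdigit_eq {p : ℕ} (hp : 1 < p) {σ τ : ℝ} (hσ : σ ∈ Set.Ico (0 : ℝ) 1)
    (hτ : τ ∈ Set.Ico (0 : ℝ) 1) (h : ∀ r, rdigit p σ r = rdigit p τ r) : σ = τ := by
  have : NeZero p := ⟨by omega⟩
  rw [← Real.ofDigits_digits hp hσ, ← Real.ofDigits_digits hp hτ]
  congr 1
  ext r
  simpa [Real.digits, rdigit, Int.floor_toNat, Fin.ofNat] using h r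

/-- For each `x`, at most one shift produces the digit expansion consisting of `p - 1` only. -/
lemma subsingleton_tsum_sdigit_eq_one {p : ℕ} (hp : 1 < p) (x : ℝ) :
    {σ ∈ Set.Ico (0 : ℝ) 1 |
      ∑' r : ℕ, (sdigit p x σ r : ℝ) / (p : ℝ) ^ (r + 1) = 1}.Subsingleton := by
  rintro σ ⟨hσ, h1⟩ τ ⟨hτ, h2⟩
  have hcomm : ∀ (a b : ℝ) (K : ℕ), shiftNum p a b K = shiftNum p b a K := by
    intro a b K
    induction K with
    | zero => rfl
    | succ K ih => rw [shiftNum, shiftNum, ih, sdigit_comm]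
  refine eq_of_rdigit_eq hp hσ hτ fun r => ?_
  refine rdigit_eq_of_shiftNum_eq (by omega) (σ := x) ?_ (Nat.lt_succ_self r)
  rw [hcomm, shiftNum_eq_of_tsum_eq_one hp h1, hcomm, shiftNum_eq_of_tsum_eq_one hp h2]

lemma ae_tendsto_midShift {p : ℕ} (hp : 1 < p) (x : ℝ) :
    ∀ᵐ σ ∂(volume.restrict (Set.Ico (0 : ℝ) 1)),
      Filter.Tendsto (fun K => midShift p K x σ) Filter.atTop (nhds (pshift p x σ)) := by
  rw [ae_restrict_iff' measurableSet_Ico]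
  have hnull := (subsingleton_tsum_sdigit_eq_one hp x).measure_zero volume
  filter_upwards [measure_eq_zero_iff_ae_notMem.mp hnull] with σ hσ hmem
  have hne : ∑' r : ℕ, (sdigit p x σ r : ℝ) / (p : ℝ) ^ (r + 1) ≠ 1 := fun h => hσ ⟨hmem, h⟩
  have hle := tsum_natDigits_div_le_one fun r => sdigit_lt (p := p) (by omega) x σ r
  have h0 : 0 ≤ ∑' r : ℕ, (sdigit p x σ r : ℝ) / (p : ℝ) ^ (r + 1) :=
    tsum_nonneg fun _ => by positivity
  rw [pshift, Int.fract_eq_self.mpr ⟨h0, lt_of_le_of_ne hle hne⟩]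
  exact tendsto_midShift hp x σ

lemma tendsto_avgMidErr {p : ℕ} (hp : 1 < p) (N : ℕ) (γ : ℝ) :
    Filter.Tendsto (fun K => avgMidErr p N K γ) Filter.atTop
      (nhds (∫ σ in Set.Ico (0 : ℝ) 1,
        sqErrOne N γ fun n => pshift p (radInv p n.val) σ)) := by
  have hp0 : 0 < p := by omega
  simp only [avgMidErr_eq_integral hp0]
  obtain ⟨C, hC⟩ := (isCompact_Icc (a := (0 : Fin N → ℝ)) (b := 1)).exists_bound_of_continuousOn
    (continuous_sqErrOne N γ).continuousOn
  refine tendsto_integral_of_dominated_convergence (fun _ => C) (fun K => ?_)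
    (integrable_const C) (fun K => ?_) ?_
  · exact ((continuous_sqErrOne N γ).measurable.comp
      (measurable_pi_lambda _ fun n => measurable_midShift hp0 K _)).aestronglyMeasurable
  · exact Filter.Eventually.of_forall fun σ => hC _
      ⟨fun n => (midShift_mem_Icc hp0 _ σ K).1, fun n => (midShift_mem_Icc hp0 _ σ K).2⟩
  · filter_upwards [ae_all_iff.mpr fun n : Fin N => ae_tendsto_midShift hp (radInv p n.val)]
      with σ hσ
    exact ((continuous_sqErrOne N γ).tendsto _).comp (tendsto_pi_nhds.mpr hσ)

lemma avgMidErr_le_integral {p : ℕ} (hp : 1 < p) {N m : ℕ} (hNm : N < p ^ m) {γ : ℝ}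
    (hγ : 0 ≤ γ) : avgMidErr p N m γ ≤ ∫ σ in Set.Ico (0 : ℝ) 1,
      sqErrOne N γ fun n => pshift p (radInv p n.val) σ := by
  refine ge_of_tendsto (tendsto_avgMidErr hp N γ) ?_
  filter_upwards [Filter.eventually_ge_atTop m] with K hK
  induction K, hK using Nat.le_induction with
  | base => exact le_rfl
  | succ K hK ih =>
    exact ih.trans (avgMidErr_le_succ hp
      (hNm.trans_le (Nat.pow_le_pow_right (by omega) hK)) hγ)

/-- the mean square worst-case error over all one-dimensional `p`-adic
shifts dominates the average over the finite set `ℚ(p^m)` of mid-simplified shifts; in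
particular a good mid-simplified shift `σ' ∈ ℚ(p^m)` exists. -/
theorem exists_good_midshift_dim_one
    (p : ℕ) (hp : p.Prime) (N : ℕ) (hN : 1 ≤ N)
    (m : ℕ) (hm : 0 < m) (hmN : N < p ^ m) (hmmin : ∀ k, 0 < k → N < p ^ k → m ≤ k)
    (γ₁ : ℝ) (hγpos : 0 < γ₁) (hγ1 : γ₁ ≤ 1) :
    ((p : ℝ) ^ m)⁻¹ *
        (∑ ℓ ∈ Finset.range (p ^ m),
          sqErr 1 N (fun _ => γ₁)
            (fun n _ => midShift p m (radInv p n.val) ((ℓ : ℝ) / (p : ℝ) ^ m))) ≤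
      (∫ σ in Set.Ico (0 : ℝ) 1,
        sqErr 1 N (fun _ => γ₁) fun n _ => pshift p (radInv p n.val) σ) ∧
    ∃ σ' : ℝ, QSet p m σ' ∧
      sqErr 1 N (fun _ => γ₁) (fun n _ => midShift p m (radInv p n.val) σ') ≤
        ∫ σ in Set.Ico (0 : ℝ) 1,
          sqErr 1 N (fun _ => γ₁) fun n _ => pshift p (radInv p n.val) σ := by
  have hpm : 0 < p ^ m := pow_pos hp.pos m
  have havg := avgMidErr_le_integral hp.one_lt hmN hγpos.le
  refine ⟨havg, ?_⟩
  have hpR : (0 : ℝ) < (p : ℝ) ^ m := by exact_mod_cast hpm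
  obtain ⟨l, hl, hle⟩ : ∃ l ∈ range (p ^ m),
      sqErrOne N γ₁ (fun n => midShift p m (radInv p n.val) ((l : ℝ) / (p : ℝ) ^ m))
        ≤ avgMidErr p N m γ₁ := by
    refine Finset.exists_le_of_sum_le (Finset.nonempty_range_iff.mpr hpm.ne') ?_
    rw [Finset.sum_const, card_range, nsmul_eq_mul, avgMidErr, Nat.cast_pow,
      mul_inv_cancel_left₀ hpR.ne']
  exact ⟨_, ⟨l, Finset.mem_range.mp hl, rfl⟩, hle.trans havg⟩
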